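/- Let n ≥ 2 be an integer and λ > 0 a real number. Let S : [0,∞) → [0,∞) be an increasing function such that ∫₀¹ S(t·x)(1−x²)^{n−2} x dx ≤ t^λ for all t ∈ [0,∞). Then ∫₀^∞ S(t)·t^{2λ−1}/(1+t^{2λ})² dt ≤ (π/2)·((n−1)/λ)·(1 + (1/2)·(λ/(n−1)))^{n−1}·(1 + 2·(n−1)/λ)^{λ/2}. -/

import Mathlib

open MeasureTheory Filter Topology Set

lemma hasDerivAt_half_arctan_sub {lam t : ℝ} (ht : 0 < t) :
    HasDerivAt (fun t : ℝ => (Real.arctan (t ^ lam) - t ^ lam / (1 + (t ^ lam) ^ 2)) / 2)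
      (lam * (t ^ lam * t ^ (2 * lam - 1) / (1 + t ^ (2 * lam)) ^ 2)) t := by
  have hv : HasDerivAt (fun t : ℝ => t ^ lam) (lam * t ^ (lam - 1)) t :=
    Real.hasDerivAt_rpow_const (Or.inl ht.ne')
  have hden : (1 + (t ^ lam) ^ 2) ≠ 0 := by positivity
  have h := (hv.arctan.sub (hv.div ((hv.pow 2).const_add 1) hden)).div_const 2
  refine h.congr_deriv ?_
  have h2 : t ^ (2 * lam) = (t ^ lam) ^ 2 := by
    rw [mul_comm, Real.rpow_mul ht.le]; norm_cast
  rw [Real.rpow_sub ht, Real.rpow_sub ht, Real.rpow_one, h2]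
  have := ht.ne'
  simp only [Pi.pow_apply]
  field_simp
  ring

lemma tendsto_half_arctan_sub {lam : ℝ} (hlam : 0 < lam) :
    Tendsto (fun t : ℝ => (Real.arctan (t ^ lam) - t ^ lam / (1 + (t ^ lam) ^ 2)) / 2)
      atTop (𝓝 (Real.pi / 4)) := by
  have h1 : Tendsto Real.arctan atTop (𝓝 (Real.pi / 2)) :=
    Real.tendsto_arctan_atTop.mono_right nhdsWithin_le_nhds
  have h2 : Tendsto (fun v : ℝ => v / (1 + v ^ 2)) atTop (𝓝 0) := by
    refine squeeze_zero' ?_ ?_ tendsto_inv_atTop_zero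
    · filter_upwards [eventually_gt_atTop 0] with v hv
      positivity
    · filter_upwards [eventually_gt_atTop 0] with v hv
      rw [div_le_iff₀ (by positivity)]
      field_simp
      linarith
  have h := ((h1.sub h2).div_const 2).comp (tendsto_rpow_atTop hlam)
  rwa [show (Real.pi / 2 - 0) / 2 = Real.pi / 4 by ring] at h

lemma integrableOn_and_integral_rpow_div_sq {lam : ℝ} (hlam : 0 < lam) :
    IntegrableOn (fun t : ℝ => t ^ lam * t ^ (2 * lam - 1) / (1 + t ^ (2 * lam)) ^ 2) (Ioi 0) ∧
      ∫ t in Ioi (0 : ℝ), t ^ lam * t ^ (2 * lam - 1) / (1 + t ^ (2 * lam)) ^ 2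
        = Real.pi / (4 * lam) := by
  have hcont : ContinuousWithinAt
      (fun t : ℝ => (Real.arctan (t ^ lam) - t ^ lam / (1 + (t ^ lam) ^ 2)) / 2) (Ici 0) 0 := by
    have hc : Continuous (fun t : ℝ => t ^ lam) := Real.continuous_rpow_const hlam.le
    have hd : ∀ t : ℝ, 1 + (t ^ lam) ^ 2 ≠ 0 := fun t => by positivity
    exact (((Real.continuous_arctan.comp hc).sub
      (hc.div (continuous_const.add (hc.pow 2)) hd)).div_const 2).continuousWithinAt
  have hpos : ∀ t ∈ Ioi (0 : ℝ),
      0 ≤ lam * (t ^ lam * t ^ (2 * lam - 1) / (1 + t ^ (2 * lam)) ^ 2) := by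
    intro t ht
    have : 0 < t := ht
    positivity
  have hi := integrableOn_Ioi_deriv_of_nonneg hcont
    (fun t ht => hasDerivAt_half_arctan_sub ht) hpos (tendsto_half_arctan_sub hlam)
  have he := integral_Ioi_of_hasDerivAt_of_nonneg hcont
    (fun t ht => hasDerivAt_half_arctan_sub ht) hpos (tendsto_half_arctan_sub hlam)
  constructor
  · refine (hi.const_mul lam⁻¹).congr (Eventually.of_forall fun t => ?_)
    exact inv_mul_cancel_left₀ hlam.ne' _
  · rw [integral_const_mul] at he
    simp only [Real.zero_rpow hlam.ne', Real.arctan_zero] at he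
    field_simp
    linarith

lemma integral_one_sub_sq_pow_mul (k : ℕ) (a : ℝ) :
    ∫ x in a..1, (1 - x ^ 2) ^ k * x = (1 - a ^ 2) ^ (k + 1) / (2 * (k + 1)) := by
  have hd : ∀ x : ℝ, HasDerivAt (fun x : ℝ => -((1 - x ^ 2) ^ (k + 1) / (2 * ((k : ℝ) + 1))))
      ((1 - x ^ 2) ^ k * x) x := by
    intro x
    have h := ((((hasDerivAt_id x).pow 2).const_sub 1).pow (k + 1)).div_const (2 * ((k : ℝ) + 1))
    refine h.neg.congr_deriv ?_
    have : (k : ℝ) + 1 ≠ 0 := by positivity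
    simp
    field_simp
  rw [intervalIntegral.integral_eq_sub_of_hasDerivAt (fun x _ => hd x)
    (Continuous.intervalIntegrable (by fun_prop) _ _)]
  simp

/-- Monotonicity turns the averaged bound on `S` into a pointwise one. -/
lemma mul_one_sub_sq_pow_le_integral {S : ℝ → ℝ} (hS : ∀ x ∈ Ici (0 : ℝ), 0 ≤ S x)
    (hmono : MonotoneOn S (Ici 0)) (k : ℕ) {t a : ℝ} (ht : 0 ≤ t) (ha0 : 0 ≤ a) (ha1 : a ≤ 1) :
    S (t * a) * ((1 - a ^ 2) ^ (k + 1) / (2 * (k + 1))) ≤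
      ∫ x in (0 : ℝ)..1, S (t * x) * (1 - x ^ 2) ^ k * x := by
  have hint : ∀ b c : ℝ, 0 ≤ b → 0 ≤ c →
      IntervalIntegrable (fun x => S (t * x) * (1 - x ^ 2) ^ k * x) volume b c := by
    intro b c hb hc
    have hm : MonotoneOn (fun x => S (t * x)) (uIcc b c) := by
      intro x hx y hy hxy
      have hx0 : 0 ≤ x := (le_min hb hc).trans hx.1
      exact hmono (mul_nonneg ht hx0) (mul_nonneg ht (hx0.trans hxy))
        (mul_le_mul_of_nonneg_left hxy ht)
    exact (hm.intervalIntegrable.mul_continuousOn (by fun_prop)).mul_continuousOn (by fun_prop)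
  have hw : ∀ x : ℝ, 0 ≤ x → x ≤ 1 → 0 ≤ (1 - x ^ 2) ^ k := fun x h0 h1 =>
    pow_nonneg (by nlinarith) k
  rw [← intervalIntegral.integral_add_adjacent_intervals (hint 0 a le_rfl ha0)
    (hint a 1 ha0 zero_le_one), ← integral_one_sub_sq_pow_mul,
    ← intervalIntegral.integral_const_mul]
  refine le_add_of_nonneg_of_le (intervalIntegral.integral_nonneg ha0 fun x hx => ?_)
    (intervalIntegral.integral_mono_on ha1 (Continuous.intervalIntegrable (by fun_prop) _ _)
      (hint a 1 ha0 zero_le_one) fun x hx => ?_)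
  · exact mul_nonneg (mul_nonneg (hS _ (mul_nonneg ht hx.1)) (hw x hx.1 (hx.2.trans ha1))) hx.1
  · have hx0 : 0 ≤ x := ha0.trans hx.1
    rw [mul_assoc]
    exact mul_le_mul_of_nonneg_right
      (hmono (mul_nonneg ht ha0) (mul_nonneg ht hx0) (mul_le_mul_of_nonneg_left hx.1 ht))
      (mul_nonneg (hw x hx0 hx.2) hx0)

/-- rough upper bound for the integral, without any convexity assumption. -/
theorem stmt_19 (n : ℕ) (hn : 2 ≤ n) (lam : ℝ) (hlam : 0 < lam)
    (S : ℝ → ℝ)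
    (hSnonneg : ∀ x ∈ Set.Ici (0:ℝ), 0 ≤ S x)
    (hSmono : MonotoneOn S (Set.Ici 0))
    (hyp : ∀ t ∈ Set.Ici (0:ℝ),
      ∫ x in (0:ℝ)..1, S (t * x) * (1 - x^2)^(n-2) * x ≤ t ^ lam) :
    ∫ t in Set.Ioi (0:ℝ), S t * t ^ (2*lam - 1) / (1 + t ^ (2*lam))^2 ≤
      (Real.pi / 2) * (((n:ℝ) - 1) / lam) *
        (1 + (1/2) * (lam / ((n:ℝ) - 1)))^(n-1) *
        (1 + 2 * ((n:ℝ) - 1) / lam) ^ (lam/2) := by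
  obtain ⟨k, rfl⟩ := Nat.exists_eq_add_of_le' hn
  have hk : (((k + 2 : ℕ) : ℝ) - 1) = k + 1 := by push_cast; ring
  rw [hk, show k + 2 - 1 = k + 1 by omega]
  rw [show k + 2 - 2 = k by omega] at hyp
  set m : ℝ := (k : ℝ) + 1 with hm
  have hm0 : 0 < m := by positivity
  set A : ℝ := 1 + (1 / 2) * (lam / m) with hA
  set B : ℝ := 1 + 2 * m / lam with hB
  have hA0 : 0 < A := by positivity
  have hB0 : 0 < B := by positivity
  have hB1 : 1 ≤ B := by rw [hB]; linarith [show 0 < 2 * m / lam by positivity]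
  have hAB : 1 - B⁻¹ = A⁻¹ := by
    rw [hA, hB]; field_simp; ring
  have hsq : (√B)⁻¹ ^ 2 = B⁻¹ := by rw [inv_pow, Real.sq_sqrt hB0.le]
  have hsB : 0 < √B := Real.sqrt_pos.2 hB0
  have hbound : ∀ t ∈ Ioi (0 : ℝ), S t ≤ 2 * m * A ^ (k + 1) * B ^ (lam / 2) * t ^ lam := by
    intro t ht
    have ht0 : 0 < t := ht
    have h := (mul_one_sub_sq_pow_le_integral hSnonneg hSmono k (t := t * √B) (a := (√B)⁻¹)
      (by positivity) (by positivity) (inv_le_one_of_one_le₀ (Real.one_le_sqrt.2 hB1))).trans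
      (hyp _ (mem_Ici.2 (by positivity)))
    rw [mul_inv_cancel_right₀ hsB.ne', hsq, hAB, Real.mul_rpow ht0.le hsB.le,
      Real.sqrt_eq_rpow, ← Real.rpow_mul hB0.le, ← hm, inv_pow, one_div_mul_eq_div] at h
    calc S t = (S t * ((A ^ (k + 1))⁻¹ / (2 * m))) * (2 * m * A ^ (k + 1)) := by
          field_simp
      _ ≤ (t ^ lam * B ^ (lam / 2)) * (2 * m * A ^ (k + 1)) := by gcongr
      _ = _ := by ring
  obtain ⟨hi, he⟩ := integrableOn_and_integral_rpow_div_sq hlam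
  calc ∫ t in Ioi (0 : ℝ), S t * t ^ (2 * lam - 1) / (1 + t ^ (2 * lam)) ^ 2
      ≤ ∫ t in Ioi (0 : ℝ), 2 * m * A ^ (k + 1) * B ^ (lam / 2) *
          (t ^ lam * t ^ (2 * lam - 1) / (1 + t ^ (2 * lam)) ^ 2) := by
        refine integral_mono_of_nonneg ?_ (hi.const_mul _) ?_
        · filter_upwards [ae_restrict_mem measurableSet_Ioi] with t ht
          have ht0 : 0 < t := ht
          have := hSnonneg t ht0.le
          simp only [Pi.zero_apply]
          positivity
        · filter_upwards [ae_restrict_mem measurableSet_Ioi] with t ht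
          have ht0 : 0 < t := ht
          rw [← mul_div_assoc, ← mul_assoc]
          gcongr
          exact hbound t ht
    _ = _ := by
        rw [integral_const_mul, he]
        field_simp
        ring
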